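/- Let R be a left GF-closed ring and let M be a left R-module with Gfd_R(M) < ∞. Then there exists a short exact sequence of left R-modules 0 → M → M' → G → 0 such that fd_R(M') = Gfd_R(M) and G is Gorenstein flat. (The analogous statement holds for right R-modules over a right GF-closed ring.) -/

import Mathlib

/-!
Background definitions for D. Bennis, "Weak Gorenstein global dimensions".

Conventions.  All rings are associative with identity.  A *left* `R`-module is a type with
`[AddCommGroup M] [Module R M]`; a *right* `R`-module is a left module over the opposite ring,
i.e. `[Module Rᵐᵒᵖ M]`.  All "right-handed" notions below are obtained by applying the
corresponding "left-handed" notion to the opposite ring `Rᵐᵒᵖ`.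
-/

open MulOpposite

universe u

section Tensor

variable (S : Type u) [Ring S]

/-- The subgroup of relations defining the tensor product `A ⊗_S M` of a right `S`-module `A`
and a left `S`-module `M` over a (possibly noncommutative) ring `S`. -/
def tensorRels (A : Type u) [AddCommGroup A] [Module Sᵐᵒᵖ A]
    (M : Type u) [AddCommGroup M] [Module S M] :
    AddSubgroup (FreeAbelianGroup (A × M)) :=
  AddSubgroup.closure
    { x | (∃ a₁ a₂ m, x = FreeAbelianGroup.of (a₁ + a₂, m) - FreeAbelianGroup.of (a₁, m) -
            FreeAbelianGroup.of (a₂, m)) ∨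
          (∃ a m₁ m₂, x = FreeAbelianGroup.of (a, m₁ + m₂) - FreeAbelianGroup.of (a, m₁) -
            FreeAbelianGroup.of (a, m₂)) ∨
          (∃ (a : A) (r : S) (m : M), x = FreeAbelianGroup.of (op r • a, m) - FreeAbelianGroup.of (a, r • m)) }

/-- The tensor product `A ⊗_S M` (an abelian group) of a right `S`-module `A` and a left
`S`-module `M` over a (possibly noncommutative) ring `S`. -/
def NTensor (A : Type u) [AddCommGroup A] [Module Sᵐᵒᵖ A]
    (M : Type u) [AddCommGroup M] [Module S M] : Type u :=
  FreeAbelianGroup (A × M) ⧸ tensorRels S A M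

instance (A : Type u) [AddCommGroup A] [Module Sᵐᵒᵖ A]
    (M : Type u) [AddCommGroup M] [Module S M] : AddCommGroup (NTensor S A M) :=
  QuotientAddGroup.Quotient.addCommGroup _

namespace NTensor

variable {S}
variable {A A' : Type u} [AddCommGroup A] [Module Sᵐᵒᵖ A] [AddCommGroup A'] [Module Sᵐᵒᵖ A']
variable {M M' : Type u} [AddCommGroup M] [Module S M] [AddCommGroup M'] [Module S M']

/-- Functoriality of `A ⊗_S −` : the map `A ⊗_S M → A ⊗_S M'` induced by a linear map
`g : M → M'` of left `S`-modules. -/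
def rmap (A : Type u) [AddCommGroup A] [Module Sᵐᵒᵖ A] (g : M →ₗ[S] M') :
    NTensor S A M →+ NTensor S A M' :=
  QuotientAddGroup.map (tensorRels S A M) (tensorRels S A M') (FreeAbelianGroup.map (Prod.map id g)) (by
    simp only [tensorRels]
    refine (AddSubgroup.closure_le _).2 ?_
    rintro x (⟨a₁, a₂, m, rfl⟩ | ⟨a, m₁, m₂, rfl⟩ | ⟨a, r, m, rfl⟩) <;>
      refine SetLike.mem_coe.2 (AddSubgroup.mem_comap.2 (AddSubgroup.subset_closure ?_)) <;>
      simp only [map_sub, map_add, map_smul, FreeAbelianGroup.map_of_apply, Prod.map_apply,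
        id_eq, Set.mem_setOf_eq]
    · exact Or.inl ⟨a₁, a₂, g m, rfl⟩
    · exact Or.inr (Or.inl ⟨a, g m₁, g m₂, rfl⟩)
    · exact Or.inr (Or.inr ⟨a, r, g m, rfl⟩))

/-- Functoriality of `− ⊗_S M` : the map `A ⊗_S M → A' ⊗_S M` induced by a linear map
`f : A → A'` of right `S`-modules. -/
def lmap (M : Type u) [AddCommGroup M] [Module S M] (f : A →ₗ[Sᵐᵒᵖ] A') :
    NTensor S A M →+ NTensor S A' M :=
  QuotientAddGroup.map (tensorRels S A M) (tensorRels S A' M) (FreeAbelianGroup.map (Prod.map f id)) (by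
    simp only [tensorRels]
    refine (AddSubgroup.closure_le _).2 ?_
    rintro x (⟨a₁, a₂, m, rfl⟩ | ⟨a, m₁, m₂, rfl⟩ | ⟨a, r, m, rfl⟩) <;>
      refine SetLike.mem_coe.2 (AddSubgroup.mem_comap.2 (AddSubgroup.subset_closure ?_)) <;>
      simp only [map_sub, map_add, map_smul, FreeAbelianGroup.map_of_apply, Prod.map_apply,
        id_eq, Set.mem_setOf_eq]
    · exact Or.inl ⟨f a₁, f a₂, m, rfl⟩
    · exact Or.inr (Or.inl ⟨f a, m₁, m₂, rfl⟩)
    · exact Or.inr (Or.inr ⟨f a, r, m, rfl⟩))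

end NTensor

end Tensor

section Dims

variable (S : Type u) [Ring S]

/-- A left `S`-module `M` is *flat* if tensoring with it preserves injectivity of maps of
right `S`-modules. -/
def IsFlatMod (M : ModuleCat.{u} S) : Prop :=
  ∀ (A B : Type u) [AddCommGroup A] [Module Sᵐᵒᵖ A] [AddCommGroup B] [Module Sᵐᵒᵖ B]
    (f : A →ₗ[Sᵐᵒᵖ] B), Function.Injective f →
      Function.Injective (NTensor.lmap (↥M) f)

/-- A left `S`-module `M` is *Gorenstein flat* if there is an exact sequence
`⋯ → F (-1) → F 0 → F 1 → ⋯` of flat left `S`-modules with `M ≅ Im (F 0 → F 1)` which stays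
exact after applying `I ⊗_S −` for every injective right `S`-module `I`
(a *complete flat resolution*). -/
def IsGorensteinFlat (M : ModuleCat.{u} S) : Prop :=
  ∃ (F : ℤ → ModuleCat.{u} S) (d : ∀ n : ℤ, ↥(F n) →ₗ[S] ↥(F (n + 1))),
    (∀ n, IsFlatMod S (F n)) ∧
    (∀ n, Function.Exact (d n) (d (n + 1))) ∧
    Nonempty (↥M ≃ₗ[S] ↥(LinearMap.range (d 0))) ∧
    (∀ (I : Type u) [AddCommGroup I] [Module Sᵐᵒᵖ I], Module.Injective Sᵐᵒᵖ I →
      ∀ n, Function.Exact (NTensor.rmap I (d n)) (NTensor.rmap I (d (n + 1))))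

/-- `gflatDimLE S n M` means `Gfd_S(M) ≤ n`: there is an exact sequence
`0 → G_n → ⋯ → G_0 → M → 0` of left `S`-modules with all `G_i` Gorenstein flat. -/
def gflatDimLE : ℕ → ModuleCat.{u} S → Prop
  | 0, M => IsGorensteinFlat S M
  | n + 1, M => ∃ (K G : ModuleCat.{u} S) (ι : ↥K →ₗ[S] ↥G) (π : ↥G →ₗ[S] ↥M),
      Function.Injective ι ∧ Function.Surjective π ∧ Function.Exact ι π ∧
      IsGorensteinFlat S G ∧ gflatDimLE n K

/-- `flatDimLE S n M` means `fd_S(M) ≤ n`: there is an exact sequence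
`0 → F_n → ⋯ → F_0 → M → 0` of left `S`-modules with all `F_i` flat. -/
def flatDimLE : ℕ → ModuleCat.{u} S → Prop
  | 0, M => IsFlatMod S M
  | n + 1, M => ∃ (K F : ModuleCat.{u} S) (ι : ↥K →ₗ[S] ↥F) (π : ↥F →ₗ[S] ↥M),
      Function.Injective ι ∧ Function.Surjective π ∧ Function.Exact ι π ∧
      IsFlatMod S F ∧ flatDimLE n K

/-- `injDimLE S n M` means `id_S(M) ≤ n`: there is an exact sequence
`0 → M → I^0 → ⋯ → I^n → 0` of left `S`-modules with all `I^i` injective. -/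
def injDimLE : ℕ → ModuleCat.{u} S → Prop
  | 0, M => Module.Injective S ↥M
  | n + 1, M => ∃ (I C : ModuleCat.{u} S) (ι : ↥M →ₗ[S] ↥I) (π : ↥I →ₗ[S] ↥C),
      Function.Injective ι ∧ Function.Surjective π ∧ Function.Exact ι π ∧
      Module.Injective S ↥I ∧ injDimLE n C

/-- The Gorenstein flat dimension `Gfd_S(M) ∈ ℕ∞` of a left `S`-module `M`. -/
noncomputable def gflatDim (M : ModuleCat.{u} S) : ℕ∞ :=
  sInf {d : ℕ∞ | ∃ n : ℕ, d = n ∧ gflatDimLE S n M}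

/-- The flat dimension `fd_S(M) ∈ ℕ∞` of a left `S`-module `M`. -/
noncomputable def flatDim (M : ModuleCat.{u} S) : ℕ∞ :=
  sInf {d : ℕ∞ | ∃ n : ℕ, d = n ∧ flatDimLE S n M}

/-- The injective dimension `id_S(M) ∈ ℕ∞` of a left `S`-module `M`. -/
noncomputable def injDim (M : ModuleCat.{u} S) : ℕ∞ :=
  sInf {d : ℕ∞ | ∃ n : ℕ, d = n ∧ injDimLE S n M}

/-- The left weak Gorenstein global dimension
`l.Gwdim(S) = sup { Gfd_S(M) | M a left S-module }`.  The right weak Gorenstein global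
dimension of `S` is `gorensteinWeakGlobalDim Sᵐᵒᵖ`. -/
noncomputable def gorensteinWeakGlobalDim : ℕ∞ :=
  ⨆ M : ModuleCat.{u} S, gflatDim S M

/-- The left weak global dimension `sup { fd_S(M) | M a left S-module }`.  (By a classical
theorem it agrees with `weakGlobalDim Sᵐᵒᵖ`, and the common value is `wdim S`.) -/
noncomputable def weakGlobalDim : ℕ∞ :=
  ⨆ M : ModuleCat.{u} S, flatDim S M

/-- The left finitistic flat dimension
`l.FFD(S) = sup { fd_S(M) | M a left S-module with fd_S(M) < ∞ }`. -/
noncomputable def finitisticFlatDim : ℕ∞ :=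
  sSup {d : ℕ∞ | d ≠ ⊤ ∧ ∃ M : ModuleCat.{u} S, flatDim S M = d}

/-- The left finitistic Gorenstein flat dimension
`l.FGFD(S) = sup { Gfd_S(M) | M a left S-module with Gfd_S(M) < ∞ }`. -/
noncomputable def finitisticGFlatDim : ℕ∞ :=
  sSup {d : ℕ∞ | d ≠ ⊤ ∧ ∃ M : ModuleCat.{u} S, gflatDim S M = d}

/-- A ring `S` is *left GF-closed* if the class of Gorenstein flat left `S`-modules is closed
under extensions.  `S` is right GF-closed iff `Sᵐᵒᵖ` is left GF-closed, and GF-closed if both. -/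
def IsGFClosed : Prop :=
  ∀ (A B C : ModuleCat.{u} S) (f : ↥A →ₗ[S] ↥B) (g : ↥B →ₗ[S] ↥C),
    Function.Injective f → Function.Surjective g → Function.Exact f g →
      IsGorensteinFlat S A → IsGorensteinFlat S C → IsGorensteinFlat S B

/-- A ring `S` is *left coherent* if every finitely generated left ideal of `S` is finitely
presented (as a left `S`-module).  `S` is right coherent iff `Sᵐᵒᵖ` is left coherent. -/
def IsLeftCoherent : Prop :=
  ∀ I : Submodule S S, I.FG → Module.FinitePresentation S ↥I

/-- A ring `S` is *left IF* if every injective left `S`-module is flat.  `S` is right IF iff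
`Sᵐᵒᵖ` is left IF, and IF if both. -/
def IsLeftIF : Prop :=
  ∀ E : ModuleCat.{u} S, Module.Injective S ↥E → IsFlatMod S E

/-- A ring `S` is *left `n`-IF* if `fd_S(E) ≤ n` for every injective left `S`-module `E`.
`S` is right `n`-IF iff `Sᵐᵒᵖ` is left `n`-IF, and `n`-IF if both. -/
def IsLeftNIF (n : ℕ) : Prop :=
  ∀ E : ModuleCat.{u} S, Module.Injective S ↥E → flatDim S E ≤ (n : ℕ∞)

/-- `Ext¹_S(T, K) = 0`, expressed by its standard characterization: every extension of `T`
by `K` (i.e. every short exact sequence `0 → K → X → T → 0`) splits. -/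
def Ext1Zero (T K : ModuleCat.{u} S) : Prop :=
  ∀ (X : ModuleCat.{u} S) (ι : ↥K →ₗ[S] ↥X) (π : ↥X →ₗ[S] ↥T),
    Function.Injective ι → Function.Surjective π → Function.Exact ι π →
      ∃ ρ : ↥X →ₗ[S] ↥K, ρ.comp ι = LinearMap.id

/-- A left `S`-module `K` is *cotorsion* if `Ext¹_S(F, K) = 0` for every flat left
`S`-module `F`. -/
def IsCotorsion (K : ModuleCat.{u} S) : Prop :=
  ∀ F : ModuleCat.{u} S, IsFlatMod S F → Ext1Zero S F K

/-- `Tor₁^S(A, T) = 0` for a right `S`-module `A` and a left `S`-module `T`, expressed by its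
standard characterization: for every short exact sequence `0 → K → F → T → 0` of left
`S`-modules with `F` flat, the induced map `A ⊗_S K → A ⊗_S F` is injective. -/
def Tor1Zero (A : Type u) [AddCommGroup A] [Module Sᵐᵒᵖ A] (T : ModuleCat.{u} S) : Prop :=
  ∀ (K F : ModuleCat.{u} S) (ι : ↥K →ₗ[S] ↥F) (π : ↥F →ₗ[S] ↥T),
    IsFlatMod S F → Function.Injective ι → Function.Surjective π → Function.Exact ι π →
      Function.Injective (NTensor.rmap A ι)

/-- A left `S`-module is *finitely presented* if it admits a presentation with finitely many
generators and relations. -/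
abbrev IsFinitelyPresented (M : ModuleCat.{u} S) : Prop :=
  Module.FinitePresentation S ↥M

end Dims


section CharacterGroups

variable {A B C : Type*} [AddCommGroup A] [AddCommGroup B] [AddCommGroup C]

/-- A homomorphism of abelian groups along which every character extends is injective. -/
theorem AddMonoidHom.injective_of_characters_extend (f : A →+ B)
    (h : ∀ χ : A →+ AddCircle (1 : ℚ), ∃ ψ : B →+ AddCircle (1 : ℚ), ψ.comp f = χ) :
    Function.Injective f := by
  refine (injective_iff_map_eq_zero f).2 fun a ha => ?_
  by_contra hne
  obtain ⟨χ, hχ⟩ := CharacterModule.exists_character_apply_ne_zero_of_ne_zero hne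
  obtain ⟨ψ, hψ⟩ := h χ
  exact hχ ((DFunLike.congr_fun hψ a).symm.trans (by simp [ha]))

/-- Characters extend along injective homomorphisms of abelian groups. -/
theorem AddMonoidHom.exists_character_extension {f : A →+ B} (hf : Function.Injective f)
    (χ : A →+ AddCircle (1 : ℚ)) : ∃ ψ : B →+ AddCircle (1 : ℚ), ψ.comp f = χ :=
  (Module.Baer.of_divisible _).extension_property_addMonoidHom _ hf χ

/-- The character functor preserves exactness. -/
theorem AddMonoidHom.exists_character_factorization {f : A →+ B} {g : B →+ C}
    (h : Function.Exact f g) (ψ : B →+ AddCircle (1 : ℚ)) (hψ : ψ.comp f = 0) :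
    ∃ θ : C →+ AddCircle (1 : ℚ), θ.comp g = ψ := by
  have hker : g.ker ≤ ψ.ker := fun b hb => by
    obtain ⟨a, rfl⟩ := (h b).1 hb
    exact DFunLike.congr_fun hψ a
  obtain ⟨θ, hθ⟩ := exists_character_extension (QuotientAddGroup.kerLift_injective g)
    (QuotientAddGroup.lift g.ker ψ hker)
  refine ⟨θ, AddMonoidHom.ext fun b => ?_⟩
  exact DFunLike.congr_fun hθ (b : B ⧸ g.ker)

/-- The character functor reflects exactness. -/
theorem AddMonoidHom.exact_of_characters_factor {f : A →+ B} {g : B →+ C}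
    (h0 : g.comp f = 0)
    (h : ∀ ψ : B →+ AddCircle (1 : ℚ), ψ.comp f = 0 →
      ∃ θ : C →+ AddCircle (1 : ℚ), θ.comp g = ψ) :
    Function.Exact f g := by
  intro b
  refine ⟨fun hb => ?_, ?_⟩
  · by_contra hne
    have hq : (b : B ⧸ f.range) ≠ 0 := fun h' => hne ((QuotientAddGroup.eq_zero_iff b).1 h')
    obtain ⟨χ, hχ⟩ := CharacterModule.exists_character_apply_ne_zero_of_ne_zero hq
    obtain ⟨θ, hθ⟩ := h (AddMonoidHom.comp χ (QuotientAddGroup.mk' f.range)) (by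
      ext a
      have : (QuotientAddGroup.mk' f.range) (f a) = 0 :=
        (QuotientAddGroup.eq_zero_iff _).2 ⟨a, rfl⟩
      exact (congrArg χ this).trans (map_zero χ))
    exact hχ ((DFunLike.congr_fun hθ b).symm.trans (by simp [hb]))
  · rintro ⟨a, rfl⟩
    exact DFunLike.congr_fun h0 a

end CharacterGroups

section CharacterModules

variable {S : Type u} [Ring S]

/-- The character group of a right `S`-module is a left `S`-module. -/
instance CharacterModule.leftModule (A : Type u) [AddCommGroup A] [Module Sᵐᵒᵖ A] :
    Module S (CharacterModule A) where
  smul s χ := AddMonoidHom.comp χ (DistribSMul.toAddMonoidHom A (op s))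
  one_smul χ := CharacterModule.ext _ fun a => congrArg χ (one_smul Sᵐᵒᵖ a)
  mul_smul s t χ := CharacterModule.ext _ fun a => congrArg χ (mul_smul (op t) (op s) a)
  smul_zero _ := rfl
  smul_add _ _ _ := rfl
  add_smul s t χ := CharacterModule.ext _ fun a =>
    (congrArg χ (add_smul (op s) (op t) a)).trans (map_add χ _ _)
  zero_smul χ := CharacterModule.ext _ fun a =>
    (congrArg χ (zero_smul Sᵐᵒᵖ a)).trans (map_zero χ)

theorem CharacterModule.left_smul_apply {A : Type u} [AddCommGroup A] [Module Sᵐᵒᵖ A]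
    (s : S) (χ : CharacterModule A) (a : A) : (s • χ) a = χ (op s • a) := rfl

/-- Restriction of characters along a map of right modules, as a map of left modules. -/
def CharacterModule.leftDual {A B : Type u} [AddCommGroup A] [Module Sᵐᵒᵖ A] [AddCommGroup B]
    [Module Sᵐᵒᵖ B] (f : A →ₗ[Sᵐᵒᵖ] B) : CharacterModule B →ₗ[S] CharacterModule A where
  toFun χ := AddMonoidHom.comp χ f.toAddMonoidHom
  map_add' _ _ := rfl
  map_smul' s χ := CharacterModule.ext _ fun a => congrArg χ (f.map_smul (op s) a).symm

namespace NTensor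

variable {A B : Type u} [AddCommGroup A] [Module Sᵐᵒᵖ A] [AddCommGroup B] [Module Sᵐᵒᵖ B]
variable {M N : Type u} [AddCommGroup M] [Module S M] [AddCommGroup N] [Module S N]

/-- The pure tensor `a ⊗ m`. -/
def tmul (a : A) (m : M) : NTensor S A M :=
  QuotientAddGroup.mk' (tensorRels S A M) (FreeAbelianGroup.of (a, m))

theorem add_tmul (a₁ a₂ : A) (m : M) :
    (tmul (a₁ + a₂) m : NTensor S A M) = tmul a₁ m + tmul a₂ m := by
  rw [← sub_eq_zero, ← sub_sub]
  exact (QuotientAddGroup.eq_zero_iff _).2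
    (AddSubgroup.subset_closure (Or.inl ⟨a₁, a₂, m, rfl⟩))

theorem tmul_add (a : A) (m₁ m₂ : M) :
    (tmul a (m₁ + m₂) : NTensor S A M) = tmul a m₁ + tmul a m₂ := by
  rw [← sub_eq_zero, ← sub_sub]
  exact (QuotientAddGroup.eq_zero_iff _).2
    (AddSubgroup.subset_closure (Or.inr (Or.inl ⟨a, m₁, m₂, rfl⟩)))

theorem smul_tmul (a : A) (s : S) (m : M) :
    (tmul (op s • a) m : NTensor S A M) = tmul a (s • m) := by
  rw [← sub_eq_zero]
  exact (QuotientAddGroup.eq_zero_iff _).2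
    (AddSubgroup.subset_closure (Or.inr (Or.inr ⟨a, s, m, rfl⟩)))

theorem tmul_zero (a : A) : (tmul a (0 : M) : NTensor S A M) = 0 := by
  simpa using tmul_add a (0 : M) 0

theorem hom_ext {T : Type*} [AddCommGroup T] {φ ψ : NTensor S A M →+ T}
    (h : ∀ a m, φ (tmul a m) = ψ (tmul a m)) : φ = ψ := by
  refine QuotientAddGroup.addMonoidHom_ext _ (FreeAbelianGroup.lift_ext _ _ ?_)
  rintro ⟨a, m⟩
  exact h a m

theorem lmap_tmul (f : A →ₗ[Sᵐᵒᵖ] B) (a : A) (m : M) :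
    lmap M f (tmul a m) = tmul (f a) m := rfl

theorem rmap_tmul (g : M →ₗ[S] N) (a : A) (m : M) :
    rmap A g (tmul a m) = tmul a (g m) := rfl

/-- A character of `A ⊗_S M` gives a linear map from `M` to the character module of `A`. -/
def curry (φ : NTensor S A M →+ AddCircle (1 : ℚ)) : M →ₗ[S] CharacterModule A where
  toFun m := AddMonoidHom.mk' (fun a => φ (tmul a m)) fun a₁ a₂ => by rw [add_tmul, map_add]
  map_add' m₁ m₂ := CharacterModule.ext _ fun a =>
    (congrArg φ (tmul_add a m₁ m₂)).trans (map_add φ _ _)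
  map_smul' s m := CharacterModule.ext _ fun a => congrArg φ (smul_tmul a s m).symm

theorem curry_apply (φ : NTensor S A M →+ AddCircle (1 : ℚ)) (m : M) (a : A) :
    curry φ m a = φ (tmul a m) := rfl

/-- A linear map from `M` to the character module of `A` gives a character of `A ⊗_S M`. -/
def uncurry (f : M →ₗ[S] CharacterModule A) : NTensor S A M →+ AddCircle (1 : ℚ) :=
  QuotientAddGroup.lift (tensorRels S A M) (FreeAbelianGroup.lift fun p : A × M => f p.2 p.1) (by
    refine (AddSubgroup.closure_le _).2 ?_
    rintro x (⟨a₁, a₂, m, rfl⟩ | ⟨a, m₁, m₂, rfl⟩ | ⟨a, r, m, rfl⟩)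
    · simp [map_add]
    · have : (f m₁ + f m₂) a = f m₁ a + f m₂ a := rfl
      simp [this]
    · simp [CharacterModule.left_smul_apply])

theorem uncurry_tmul (f : M →ₗ[S] CharacterModule A) (a : A) (m : M) :
    uncurry f (tmul a m) = f m a := by
  change FreeAbelianGroup.lift _ (FreeAbelianGroup.of (a, m)) = _
  simp

end NTensor

end CharacterModules

section ExtCriteria

open CategoryTheory Abelian

variable {S : Type u} [Ring S] {X Y Z : ModuleCat.{u} S} {f : ↥X →ₗ[S] ↥Y} {g : ↥Y →ₗ[S] ↥Z}

/-- The short complex in `ModuleCat S` given by an exact pair of linear maps. -/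
abbrev Function.Exact.moduleCatShortComplex (h : Function.Exact f g) :
    ShortComplex (ModuleCat.{u} S) :=
  ShortComplex.mk (ModuleCat.ofHom f) (ModuleCat.ofHom g) (by
    ext x
    exact h.apply_apply_eq_zero x)

theorem Function.Exact.moduleCat_shortExact (h : Function.Exact f g)
    (hf : Function.Injective f) (hg : Function.Surjective g) :
    h.moduleCatShortComplex.ShortExact :=
  ModuleCat.shortComplex_shortExact _ h hf hg

variable {W : ModuleCat.{u} S}

theorem exists_linearMap_extension_of_ext_one (hf : Function.Injective f)
    (hg : Function.Surjective g) (hfg : Function.Exact f g)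
    [Subsingleton (Ext Z W 1)] (φ : ↥X →ₗ[S] ↥W) :
    ∃ ψ : ↥Y →ₗ[S] ↥W, ψ.comp f = φ := by
  obtain ⟨x, hx⟩ := Ext.contravariant_sequence_exact₁ (hfg.moduleCat_shortExact hf hg) W
    (Ext.mk₀ (ModuleCat.ofHom φ)) (add_zero 1) (Subsingleton.elim _ _)
  obtain ⟨ψ, rfl⟩ := (Ext.mk₀_bijective _ _).2 x
  rw [Ext.mk₀_comp_mk₀] at hx
  exact ⟨ψ.hom, congrArg ModuleCat.Hom.hom ((Ext.mk₀_bijective _ _).1 hx)⟩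

theorem subsingleton_ext_one_of_linearMap_extension (hf : Function.Injective f)
    (hg : Function.Surjective g) (hfg : Function.Exact f g)
    [Subsingleton (Ext Y W 1)]
    (h : ∀ φ : ↥X →ₗ[S] ↥W, ∃ ψ : ↥Y →ₗ[S] ↥W, ψ.comp f = φ) : Subsingleton (Ext Z W 1) := by
  have hS := hfg.moduleCat_shortExact hf hg
  refine subsingleton_of_forall_eq 0 fun z => ?_
  obtain ⟨x, rfl⟩ := Ext.contravariant_sequence_exact₃ hS W z (Subsingleton.elim _ _)
    (add_zero 1)
  obtain ⟨φ, rfl⟩ := (Ext.mk₀_bijective _ _).2 x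
  obtain ⟨ψ, hψ⟩ := h φ.hom
  obtain rfl : ModuleCat.ofHom f ≫ ModuleCat.ofHom ψ = φ := ModuleCat.hom_ext hψ
  rw [← Ext.mk₀_comp_mk₀]
  exact hS.extClass_comp_assoc _

theorem subsingleton_ext_succ_of_exact_right {k : ℕ} (hf : Function.Injective f)
    (hg : Function.Surjective g) (hfg : Function.Exact f g)
    [Subsingleton (Ext X W k)]
    [Subsingleton (Ext Y W (k + 1))] : Subsingleton (Ext Z W (k + 1)) := by
  refine subsingleton_of_forall_eq 0 fun z => ?_
  obtain ⟨x, rfl⟩ := Ext.contravariant_sequence_exact₃ (hfg.moduleCat_shortExact hf hg) W z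
    (Subsingleton.elim _ _) (add_comm 1 k)
  rw [Subsingleton.elim x 0, Ext.comp_zero]

theorem subsingleton_ext_of_exact_left {k : ℕ} (hf : Function.Injective f)
    (hg : Function.Surjective g) (hfg : Function.Exact f g)
    [Subsingleton (Ext Y W k)]
    [Subsingleton (Ext Z W (k + 1))] : Subsingleton (Ext X W k) := by
  refine subsingleton_of_forall_eq 0 fun x => ?_
  obtain ⟨y, rfl⟩ := Ext.contravariant_sequence_exact₁ (hfg.moduleCat_shortExact hf hg) W x
    (add_comm 1 k) (Subsingleton.elim _ _)
  rw [Subsingleton.elim y 0, Ext.comp_zero]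

theorem subsingleton_ext_one_of_linearMap_lift (hf : Function.Injective f)
    (hg : Function.Surjective g) (hfg : Function.Exact f g)
    [Subsingleton (Ext W Y 1)]
    (h : ∀ φ : ↥W →ₗ[S] ↥Z, ∃ ψ : ↥W →ₗ[S] ↥Y, g.comp ψ = φ) : Subsingleton (Ext W X 1) := by
  have hS := hfg.moduleCat_shortExact hf hg
  refine subsingleton_of_forall_eq 0 fun x => ?_
  obtain ⟨z, rfl⟩ := Ext.covariant_sequence_exact₁ W hS x (Subsingleton.elim _ _) (zero_add 1)
  obtain ⟨φ, rfl⟩ := (Ext.mk₀_bijective _ _).2 z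
  obtain ⟨ψ, hψ⟩ := h φ.hom
  obtain rfl : ModuleCat.ofHom ψ ≫ ModuleCat.ofHom g = φ := ModuleCat.hom_ext hψ
  rw [← Ext.mk₀_comp_mk₀, Ext.comp_assoc_of_second_deg_zero]
  exact (congrArg (fun t => (Ext.mk₀ (ModuleCat.ofHom ψ)).comp t (zero_add 1))
    hS.comp_extClass).trans (Ext.comp_zero _ _ _ _ _)

theorem subsingleton_ext_succ_of_exact_covariant {k : ℕ} (hf : Function.Injective f)
    (hg : Function.Surjective g) (hfg : Function.Exact f g)
    [Subsingleton (Ext W Z k)]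
    [Subsingleton (Ext W Y (k + 1))] : Subsingleton (Ext W X (k + 1)) := by
  refine subsingleton_of_forall_eq 0 fun x => ?_
  obtain ⟨z, rfl⟩ := Ext.covariant_sequence_exact₁ W (hfg.moduleCat_shortExact hf hg) x
    (Subsingleton.elim _ _) rfl
  rw [Subsingleton.elim z 0, Ext.zero_comp]

end ExtCriteria

section Flat

open CategoryTheory Abelian

variable {S : Type u} [Ring S]

theorem IsFlatMod.exists_lift_leftDual {F : ModuleCat.{u} S} (hF : IsFlatMod S F) {A B : Type u}
    [AddCommGroup A] [Module Sᵐᵒᵖ A] [AddCommGroup B] [Module Sᵐᵒᵖ B] {f : A →ₗ[Sᵐᵒᵖ] B}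
    (hf : Function.Injective f) (φ : ↥F →ₗ[S] CharacterModule A) :
    ∃ ψ : ↥F →ₗ[S] CharacterModule B, (CharacterModule.leftDual f).comp ψ = φ := by
  obtain ⟨ψ, hψ⟩ := AddMonoidHom.exists_character_extension (hF A B f hf) (NTensor.uncurry φ)
  refine ⟨NTensor.curry ψ, LinearMap.ext fun m => CharacterModule.ext _ fun a => ?_⟩
  rw [← NTensor.uncurry_tmul φ, ← hψ]
  rfl

theorem CharacterModule.leftDual_exact {A B C : Type u} [AddCommGroup A] [Module Sᵐᵒᵖ A]
    [AddCommGroup B] [Module Sᵐᵒᵖ B] [AddCommGroup C] [Module Sᵐᵒᵖ C] {f : A →ₗ[Sᵐᵒᵖ] B}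
    {g : B →ₗ[Sᵐᵒᵖ] C} (h : Function.Exact f g) :
    Function.Exact (CharacterModule.leftDual (S := S) g) (CharacterModule.leftDual f) := by
  intro ψ
  refine ⟨fun hψ => ?_, ?_⟩
  · exact AddMonoidHom.exists_character_factorization (f := f.toAddMonoidHom)
      (g := g.toAddMonoidHom) h ψ hψ
  · rintro ⟨θ, rfl⟩
    refine CharacterModule.ext _ fun a => ?_
    exact (congrArg θ (h.apply_apply_eq_zero a)).trans (map_zero θ)

theorem CharacterModule.leftDual_surjective {A B : Type u} [AddCommGroup A] [Module Sᵐᵒᵖ A]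
    [AddCommGroup B] [Module Sᵐᵒᵖ B] {f : A →ₗ[Sᵐᵒᵖ] B} (hf : Function.Injective f) :
    Function.Surjective (CharacterModule.leftDual (S := S) f) :=
  AddMonoidHom.exists_character_extension (f := f.toAddMonoidHom) hf

theorem CharacterModule.leftDual_injective {A B : Type u} [AddCommGroup A] [Module Sᵐᵒᵖ A]
    [AddCommGroup B] [Module Sᵐᵒᵖ B] {f : A →ₗ[Sᵐᵒᵖ] B} (hf : Function.Surjective f) :
    Function.Injective (CharacterModule.leftDual (S := S) f) := by
  intro χ ψ h
  refine CharacterModule.ext _ fun b => ?_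
  obtain ⟨a, rfl⟩ := hf b
  exact DFunLike.congr_fun h a

/-- Projective modules are flat. -/
theorem isFlatMod_of_projective (P : ModuleCat.{u} S) [Module.Projective S ↥P] :
    IsFlatMod S P := by
  intro A B _ _ _ _ f hf
  refine AddMonoidHom.injective_of_characters_extend _ fun χ => ?_
  obtain ⟨ψ, hψ⟩ := Module.projective_lifting_property (CharacterModule.leftDual f)
    (NTensor.curry χ) (CharacterModule.leftDual_surjective hf)
  refine ⟨NTensor.uncurry ψ, NTensor.hom_ext fun a m => ?_⟩
  rw [AddMonoidHom.comp_apply, NTensor.lmap_tmul, NTensor.uncurry_tmul, ← NTensor.curry_apply,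
    ← hψ]
  rfl

/-- The character module of a free right module is an injective left module. -/
theorem CharacterModule.injective_of_finsupp (ι : Type u) :
    Module.Injective S (CharacterModule (ι →₀ Sᵐᵒᵖ)) where
  out X Y _ _ _ _ f hf g := by
    have hext (i : ι) := AddMonoidHom.exists_character_extension (f := f.toAddMonoidHom) hf
      (AddMonoidHom.mk' (fun x => g x (Finsupp.single i 1)) fun x y => by rw [map_add]; rfl)
    choose ψ hψ using hext
    let T (y : Y) : (ι →₀ Sᵐᵒᵖ) →+ AddCircle (1 : ℚ) := Finsupp.liftAddHom fun i =>
      AddMonoidHom.mk' (fun s : Sᵐᵒᵖ => ψ i (unop s • y)) fun s t => by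
        rw [MulOpposite.unop_add, add_smul, map_add]
    have hT (y : Y) (i : ι) (s : Sᵐᵒᵖ) : T y (Finsupp.single i s) = ψ i (unop s • y) := by
      simp [T]
    let h : Y →ₗ[S] CharacterModule (ι →₀ Sᵐᵒᵖ) :=
      { toFun := T
        map_add' := fun y z => by
          refine Finsupp.addHom_ext fun i s => ?_
          change T (y + z) (Finsupp.single i s) = T y (Finsupp.single i s) +
            T z (Finsupp.single i s)
          rw [hT, hT, hT, smul_add, map_add]
        map_smul' := fun r y => by
          refine Finsupp.addHom_ext fun i s => ?_
          change T (r • y) (Finsupp.single i s) = T y (op r • Finsupp.single i s)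
          rw [Finsupp.smul_single, hT, hT, smul_eq_mul, unop_mul, unop_op, mul_smul] }
    refine ⟨h, fun x => Finsupp.addHom_ext fun i s => ?_⟩
    have hx : ψ i (f (unop s • x)) = g (unop s • x) (Finsupp.single i 1) :=
      DFunLike.congr_fun (hψ i) (unop s • x)
    rw [f.map_smul, g.map_smul, CharacterModule.left_smul_apply, Finsupp.smul_single] at hx
    exact (hT (f x) i s).trans
      (hx.trans (congrArg (fun t => g x (Finsupp.single i t)) (mul_one s)))

theorem IsFlatMod.subsingleton_ext_characterModule {F : ModuleCat.{u} S} (hF : IsFlatMod S F)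
    (k : ℕ) (A : Type u) [AddCommGroup A] [Module Sᵐᵒᵖ A] :
    Subsingleton (Ext F (ModuleCat.of S (CharacterModule A)) (k + 1)) := by
  induction k generalizing A with
  | zero =>
    let p : (A →₀ Sᵐᵒᵖ) →ₗ[Sᵐᵒᵖ] A := Finsupp.linearCombination Sᵐᵒᵖ id
    have hp : Function.Surjective p := Finsupp.linearCombination_id_surjective _ _
    have := CharacterModule.injective_of_finsupp (S := S) A
    have : Injective (ModuleCat.of S (CharacterModule (A →₀ Sᵐᵒᵖ))) :=
      Module.injective_object_of_injective_module S _
    have := Ext.subsingleton_of_injective F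
      (ModuleCat.of S (CharacterModule (A →₀ Sᵐᵒᵖ))) 0
    refine subsingleton_ext_one_of_linearMap_lift
      (X := ModuleCat.of S (CharacterModule A))
      (Y := ModuleCat.of S (CharacterModule (A →₀ Sᵐᵒᵖ)))
      (Z := ModuleCat.of S (CharacterModule ↥(LinearMap.ker p)))
      (CharacterModule.leftDual_injective hp)
      (CharacterModule.leftDual_surjective (LinearMap.ker p).injective_subtype)
      (CharacterModule.leftDual_exact (LinearMap.exact_subtype_ker_map p)) fun φ => ?_
    exact hF.exists_lift_leftDual (LinearMap.ker p).injective_subtype φ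
  | succ k ih =>
    let p : (A →₀ Sᵐᵒᵖ) →ₗ[Sᵐᵒᵖ] A := Finsupp.linearCombination Sᵐᵒᵖ id
    have hp : Function.Surjective p := Finsupp.linearCombination_id_surjective _ _
    have := CharacterModule.injective_of_finsupp (S := S) A
    have : Injective (ModuleCat.of S (CharacterModule (A →₀ Sᵐᵒᵖ))) :=
      Module.injective_object_of_injective_module S _
    have := Ext.subsingleton_of_injective F
      (ModuleCat.of S (CharacterModule (A →₀ Sᵐᵒᵖ))) (k + 1)
    have := ih ↥(LinearMap.ker p)
    exact subsingleton_ext_succ_of_exact_covariant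
      (X := ModuleCat.of S (CharacterModule A))
      (Y := ModuleCat.of S (CharacterModule (A →₀ Sᵐᵒᵖ)))
      (Z := ModuleCat.of S (CharacterModule ↥(LinearMap.ker p)))
      (CharacterModule.leftDual_injective hp)
      (CharacterModule.leftDual_surjective (LinearMap.ker p).injective_subtype)
      (CharacterModule.leftDual_exact (LinearMap.exact_subtype_ker_map p))

end Flat

section GorensteinFlat

open CategoryTheory Abelian

variable {S : Type u} [Ring S]

theorem LinearMap.exists_comp_eq_of_ker_le {M N P : Type*} [AddCommGroup M] [Module S M]
    [AddCommGroup N] [Module S N] [AddCommGroup P] [Module S P] {g : M →ₗ[S] N}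
    (hg : Function.Surjective g) (φ : M →ₗ[S] P) (h : LinearMap.ker g ≤ LinearMap.ker φ) :
    ∃ ψ : N →ₗ[S] P, ψ.comp g = φ := by
  refine ⟨((LinearMap.ker g).liftQ φ h).comp (g.quotKerEquivOfSurjective hg).symm.toLinearMap,
    LinearMap.ext fun m => ?_⟩
  have : (g.quotKerEquivOfSurjective hg).symm (g m) = (LinearMap.ker g).mkQ m := by
    rw [LinearEquiv.symm_apply_eq]
    rfl
  simp [this]

/-- There is a short exact sequence `0 → X → F → Y → 0` with `F` flat. -/
def FlatStep (X Y : ModuleCat.{u} S) : Prop :=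
  ∃ (F : ModuleCat.{u} S) (f : ↥X →ₗ[S] ↥F) (g : ↥F →ₗ[S] ↥Y), IsFlatMod S F ∧
    Function.Injective f ∧ Function.Surjective g ∧ Function.Exact f g

theorem FlatStep.of_equiv {X X' Y Y' : ModuleCat.{u} S} (h : FlatStep X Y)
    (e : ↥X' ≃ₗ[S] ↥X) (e' : ↥Y ≃ₗ[S] ↥Y') : FlatStep X' Y' := by
  obtain ⟨F, f, g, hF, hf, hg, hfg⟩ := h
  refine ⟨F, f.comp e.toLinearMap, e'.toLinearMap.comp g, hF, hf.comp e.injective,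
    e'.surjective.comp hg, fun y => ?_⟩
  simp only [LinearMap.comp_apply, LinearEquiv.coe_coe, e'.map_eq_zero_iff, Set.mem_range]
  rw [hfg y]
  exact (e.surjective.exists (p := fun x => f x = y))

/-- `Tor_k(I, M) = 0` for all `k ≥ 1` and all injective right modules `I`, expressed through the
vanishing of `Ext` into character modules. -/
def IsInjTorAcyclic (M : ModuleCat.{u} S) : Prop :=
  ∀ (I : Type u) [AddCommGroup I] [Module Sᵐᵒᵖ I], Module.Injective Sᵐᵒᵖ I →
    ∀ k : ℕ, Subsingleton (Ext M (ModuleCat.of S (CharacterModule I)) (k + 1))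

theorem IsInjTorAcyclic.of_flatStep {X Y : ModuleCat.{u} S} (hY : IsInjTorAcyclic Y)
    (h : FlatStep X Y) : IsInjTorAcyclic X := by
  obtain ⟨F, f, g, hF, hf, hg, hfg⟩ := h
  intro I _ _ hI k
  have := hF.subsingleton_ext_characterModule k I
  have := hY I hI (k + 1)
  exact subsingleton_ext_of_exact_left hf hg hfg

/-- The kernel of the canonical free cover of a module. -/
noncomputable def freeSyzygy (M : ModuleCat.{u} S) : ModuleCat.{u} S :=
  ModuleCat.of S ↥(LinearMap.ker (Finsupp.linearCombination S (id : ↥M → ↥M)))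

theorem flatStep_freeSyzygy (M : ModuleCat.{u} S) : FlatStep (freeSyzygy M) M :=
  ⟨ModuleCat.of S (↥M →₀ S), Submodule.subtype _, Finsupp.linearCombination S id,
    have : Module.Projective S ↥(ModuleCat.of S (↥M →₀ S)) :=
      inferInstanceAs (Module.Projective S (↥M →₀ S))
    isFlatMod_of_projective _,
    Submodule.injective_subtype _, Finsupp.linearCombination_id_surjective _ _,
    LinearMap.exact_subtype_ker_map _⟩

theorem Function.Exact.subtype_range_rangeRestrict {X Y Z : Type*} [AddCommGroup X] [Module S X]
    [AddCommGroup Y] [Module S Y] [AddCommGroup Z] [Module S Z] {f : X →ₗ[S] Y} {g : Y →ₗ[S] Z}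
    (h : Function.Exact f g) :
    Function.Exact (LinearMap.range f).subtype g.rangeRestrict := fun y => by
  rw [← Subtype.coe_inj]
  refine (h y).trans ?_
  change _ ↔ y ∈ Set.range (Subtype.val : ↥(LinearMap.range f) → Y)
  rw [Subtype.range_coe]
  rfl

theorem flatStep_range_of_exact {X Y Z : ModuleCat.{u} S} (hY : IsFlatMod S Y)
    {f : ↥X →ₗ[S] ↥Y} {g : ↥Y →ₗ[S] ↥Z} (h : Function.Exact f g) :
    FlatStep (ModuleCat.of S ↥(LinearMap.range f)) (ModuleCat.of S ↥(LinearMap.range g)) :=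
  ⟨Y, (LinearMap.range f).subtype, g.rangeRestrict, hY, Submodule.injective_subtype _,
    g.surjective_rangeRestrict, h.subtype_range_rangeRestrict⟩

theorem isInjTorAcyclic_range_of_exact {F : ℤ → ModuleCat.{u} S}
    {d : ∀ n : ℤ, ↥(F n) →ₗ[S] ↥(F (n + 1))} (hF : ∀ n, IsFlatMod S (F n))
    (hd : ∀ n, Function.Exact (d n) (d (n + 1)))
    (ht : ∀ (I : Type u) [AddCommGroup I] [Module Sᵐᵒᵖ I], Module.Injective Sᵐᵒᵖ I →
      ∀ n, Function.Exact (NTensor.rmap I (d n)) (NTensor.rmap I (d (n + 1)))) (n : ℤ) :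
    IsInjTorAcyclic (ModuleCat.of S ↥(LinearMap.range (d n))) := by
  intro I _ _ hI k
  induction k generalizing n with
  | zero =>
    obtain ⟨m, rfl⟩ : ∃ m, n = m + 1 + 1 := ⟨n - 2, by ring⟩
    have := (hF (m + 1 + 1)).subsingleton_ext_characterModule 0 I
    refine subsingleton_ext_one_of_linearMap_extension
      (X := ModuleCat.of S ↥(LinearMap.range (d (m + 1))))
      (Y := F (m + 1 + 1)) (f := (LinearMap.range (d (m + 1))).subtype)
      (g := (d (m + 1 + 1)).rangeRestrict) (Submodule.injective_subtype _)
      (LinearMap.surjective_rangeRestrict _) (hd (m + 1)).subtype_range_rangeRestrict fun φ => ?_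
    obtain ⟨θ, hθ⟩ := AddMonoidHom.exists_character_factorization (ht I hI m)
      (NTensor.uncurry (φ.comp (d (m + 1)).rangeRestrict)) (NTensor.hom_ext fun a x => by
        have : (d (m + 1)).rangeRestrict (d m x) = 0 :=
          Subtype.ext ((hd m).apply_apply_eq_zero x)
        rw [AddMonoidHom.comp_apply, NTensor.rmap_tmul, NTensor.uncurry_tmul,
          LinearMap.comp_apply, this, map_zero]
        rfl)
    refine ⟨NTensor.curry θ, LinearMap.ext ?_⟩
    rintro ⟨_, x, rfl⟩
    refine CharacterModule.ext _ fun a => ?_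
    have := DFunLike.congr_fun hθ (NTensor.tmul a x)
    rw [NTensor.uncurry_tmul] at this
    exact this
  | succ k ih =>
    obtain ⟨m, rfl⟩ : ∃ m, n = m + 1 := ⟨n - 1, by ring⟩
    obtain ⟨_, f, g, hY, hf, hg, hfg⟩ := flatStep_range_of_exact (hF _) (hd m)
    have := ih m
    have := hY.subsingleton_ext_characterModule (k + 1) I
    exact subsingleton_ext_succ_of_exact_right hf hg hfg

/-- Gorenstein flat modules are the terms of two-sided chains of short exact sequences with flat
middle terms and acyclic end terms. -/
theorem IsGorensteinFlat.exists_chain {M : ModuleCat.{u} S} (h : IsGorensteinFlat S M) :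
    ∃ Z : ℤ → ModuleCat.{u} S, Nonempty (↥M ≃ₗ[S] ↥(Z 0)) ∧
      (∀ n, FlatStep (Z n) (Z (n + 1))) ∧ ∀ n, IsInjTorAcyclic (Z n) := by
  obtain ⟨F, d, hF, hd, e, ht⟩ := h
  exact ⟨fun n => ModuleCat.of S ↥(LinearMap.range (d n)), e,
    fun n => flatStep_range_of_exact (hF _) (hd n), isInjTorAcyclic_range_of_exact hF hd ht⟩

theorem isGorensteinFlat_of_chain {M : ModuleCat.{u} S} (Z : ℤ → ModuleCat.{u} S)
    (e : ↥M ≃ₗ[S] ↥(Z (0 + 1))) (hZ : ∀ n, FlatStep (Z n) (Z (n + 1)))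
    (hac : ∀ n, IsInjTorAcyclic (Z n)) : IsGorensteinFlat S M := by
  choose F f g hF hf hg hfg using hZ
  have hker (n : ℤ) (x : ↥(F (n + 1))) :
      g (n + 1) x = 0 ↔ ∃ y, f (n + 1) (g n y) = x := by
    rw [hfg (n + 1) x]
    exact (hg n).exists (p := fun z => f (n + 1) z = x)
  have hd (n : ℤ) : Function.Exact ((f (n + 1)).comp (g n))
      ((f (n + 1 + 1)).comp (g (n + 1))) := fun x => by
    rw [LinearMap.comp_apply, map_eq_zero_iff _ (hf _)]
    exact hker n x
  refine ⟨F, fun n => (f (n + 1)).comp (g n), hF, hd, ⟨?_⟩, ?_⟩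
  · refine e.trans ((LinearEquiv.ofInjective _ (hf (0 + 1))).trans (LinearEquiv.ofEq _ _ ?_))
    rw [LinearMap.range_comp_of_range_eq_top _ (LinearMap.range_eq_top.2 (hg 0))]
  · intro I _ _ hI n
    refine AddMonoidHom.exact_of_characters_factor (NTensor.hom_ext fun a x => ?_) fun ψ hψ => ?_
    · rw [AddMonoidHom.comp_apply, NTensor.rmap_tmul, NTensor.rmap_tmul,
        (hd n).apply_apply_eq_zero, NTensor.tmul_zero]
      rfl
    · obtain ⟨φ, hφ⟩ := LinearMap.exists_comp_eq_of_ker_le (hg (n + 1)) (NTensor.curry ψ)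
        fun x hx => by
          obtain ⟨y, rfl⟩ := (hker n x).1 hx
          exact CharacterModule.ext _ fun a => DFunLike.congr_fun hψ (NTensor.tmul a y)
      have := hac (n + 1 + 1 + 1) I hI 0
      obtain ⟨θ, hθ⟩ := exists_linearMap_extension_of_ext_one
        (W := ModuleCat.of S (CharacterModule I)) (hf (n + 1 + 1)) (hg (n + 1 + 1))
        (hfg (n + 1 + 1)) φ
      refine ⟨NTensor.uncurry θ, NTensor.hom_ext fun a x => ?_⟩
      rw [AddMonoidHom.comp_apply, NTensor.rmap_tmul, NTensor.uncurry_tmul]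
      exact (DFunLike.congr_fun (LinearMap.congr_fun hθ (g (n + 1) x)) a).trans
        (DFunLike.congr_fun (LinearMap.congr_fun hφ x) a)

/-- A Gorenstein flat module embeds in a flat module with Gorenstein flat cokernel. -/
theorem IsGorensteinFlat.exists_flatStep {M : ModuleCat.{u} S} (h : IsGorensteinFlat S M) :
    ∃ G : ModuleCat.{u} S, FlatStep M G ∧ IsGorensteinFlat S G := by
  obtain ⟨Z, ⟨e⟩, hZ, hac⟩ := h.exists_chain
  exact ⟨Z (0 + 1), (hZ 0).of_equiv e (LinearEquiv.refl _ _),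
    isGorensteinFlat_of_chain Z (LinearEquiv.refl _ _) hZ hac⟩

/-- The kernel of an epimorphism from a flat module to a Gorenstein flat module is Gorenstein
flat. -/
theorem IsGorensteinFlat.of_flatStep {A Q : ModuleCat.{u} S} (hQ : IsGorensteinFlat S Q)
    (h : FlatStep A Q) : IsGorensteinFlat S A := by
  obtain ⟨Z, ⟨e⟩, hZ, hac⟩ := hQ.exists_chain
  let Z' : ℤ → ModuleCat.{u} S
    | Int.ofNat 0 => freeSyzygy A
    | Int.ofNat 1 => A
    | Int.ofNat (n + 2) => Z n
    | Int.negSucc n => freeSyzygy^[n + 1] (freeSyzygy A)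
  have hA : FlatStep A (Z 0) := h.of_equiv (LinearEquiv.refl _ _) e
  have hacA : IsInjTorAcyclic A := (hac 0).of_flatStep hA
  have hsyz (n : ℕ) : IsInjTorAcyclic (freeSyzygy^[n] (freeSyzygy A)) := by
    induction n with
    | zero => exact hacA.of_flatStep (flatStep_freeSyzygy A)
    | succ n ih =>
      rw [Function.iterate_succ_apply']
      exact ih.of_flatStep (flatStep_freeSyzygy _)
  refine isGorensteinFlat_of_chain Z' (LinearEquiv.refl _ _) (fun n => ?_) fun n => ?_
  · match n with
    | Int.ofNat 0 => exact flatStep_freeSyzygy A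
    | Int.ofNat 1 => exact hA
    | Int.ofNat (n + 2) => exact hZ n
    | Int.negSucc 0 => exact flatStep_freeSyzygy _
    | Int.negSucc (n + 1) =>
      change FlatStep (freeSyzygy^[n + 1 + 1] _) (freeSyzygy^[n + 1] _)
      rw [Function.iterate_succ_apply' _ (n + 1)]
      exact flatStep_freeSyzygy _
  · match n with
    | Int.ofNat 0 => exact hsyz 0
    | Int.ofNat 1 => exact hacA
    | Int.ofNat (n + 2) => exact hac n
    | Int.negSucc n => exact hsyz (n + 1)

end GorensteinFlat

section Dimensions

variable {S : Type u} [Ring S]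

/-- Every flat module is Gorenstein flat. -/
theorem IsFlatMod.isGorensteinFlat {F : ModuleCat.{u} S} (hF : IsFlatMod S F) :
    IsGorensteinFlat S F := by
  have hzero : IsFlatMod S (ModuleCat.of S PUnit.{u + 1}) :=
    have : Module.Projective S ↥(ModuleCat.of S PUnit.{u + 1}) :=
      inferInstanceAs (Module.Projective S PUnit.{u + 1})
    isFlatMod_of_projective _
  have : Subsingleton ↥(ModuleCat.of S PUnit.{u + 1}) := inferInstanceAs (Subsingleton PUnit)
  have hG : IsGorensteinFlat S (ModuleCat.of S PUnit.{u + 1}) :=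
    isGorensteinFlat_of_chain (fun _ => ModuleCat.of S PUnit.{u + 1}) (LinearEquiv.refl _ _)
      (fun _ => ⟨ModuleCat.of S PUnit.{u + 1}, LinearMap.id, LinearMap.id, hzero,
        Function.injective_id, Function.surjective_id,
        fun x => ⟨fun _ => ⟨x, rfl⟩, fun _ => Subsingleton.elim _ _⟩⟩)
      (fun _ I _ _ _ k => hzero.subsingleton_ext_characterModule k I)
  exact hG.of_flatStep ⟨F, LinearMap.id, 0, hF, Function.injective_id,
    fun _ => ⟨0, Subsingleton.elim _ _⟩, fun x => ⟨fun _ => ⟨x, rfl⟩, fun _ => rfl⟩⟩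

theorem flatDimLE.toGflatDimLE {n : ℕ} {M : ModuleCat.{u} S} (h : flatDimLE S n M) :
    gflatDimLE S n M := by
  induction n generalizing M with
  | zero => exact IsFlatMod.isGorensteinFlat h
  | succ n ih =>
    obtain ⟨K, F, ι, π, hι, hπ, hιπ, hF, hK⟩ := h
    exact ⟨K, F, ι, π, hι, hπ, hιπ, hF.isGorensteinFlat, ih hK⟩

/-- If `0 → M → M' → G → 0` is exact with `G` Gorenstein flat and `fd M' ≤ n`, then
`Gfd M ≤ n`. -/
theorem flatDimLE.gflatDimLE_of_exact {n : ℕ} {M M' G : ModuleCat.{u} S} (h : flatDimLE S n M')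
    (hG : IsGorensteinFlat S G) {f : ↥M →ₗ[S] ↥M'} {g : ↥M' →ₗ[S] ↥G}
    (hf : Function.Injective f) (hg : Function.Surjective g) (hfg : Function.Exact f g) :
    gflatDimLE S n M := by
  cases n with
  | zero => exact hG.of_flatStep ⟨M', f, g, h, hf, hg, hfg⟩
  | succ n =>
    obtain ⟨K, F, ι, π, hι, hπ, hιπ, hF, hK⟩ := h
    let N := LinearMap.ker (g.comp π)
    have hN : IsGorensteinFlat S (ModuleCat.of S ↥N) :=
      hG.of_flatStep ⟨F, N.subtype, g.comp π, hF, N.injective_subtype, hg.comp hπ,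
        LinearMap.exact_subtype_ker_map _⟩
    have hmem (x : ↥N) : π x ∈ LinearMap.range f := (hfg _).1 x.2
    let p : ↥N →ₗ[S] ↥M := (LinearEquiv.ofInjective f hf).symm.toLinearMap.comp
      (LinearMap.codRestrict (LinearMap.range f) (π.comp N.subtype) hmem)
    have hp (x : ↥N) : f (p x) = π x :=
      congrArg Subtype.val ((LinearEquiv.ofInjective f hf).apply_symm_apply ⟨π x, hmem x⟩)
    have hιN (k : ↥K) : ι k ∈ N := by
      simp [N, hιπ.apply_apply_eq_zero k]
    refine ⟨K, ModuleCat.of S ↥N, LinearMap.codRestrict N ι hιN, p, ?_, ?_, ?_, hN,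
      hK.toGflatDimLE⟩
    · exact fun x y hxy => hι (congrArg Subtype.val hxy)
    · intro m
      obtain ⟨x, hx⟩ := hπ (f m)
      refine ⟨⟨x, ?_⟩, hf ((hp _).trans hx)⟩
      simp [N, hx, hfg.apply_apply_eq_zero m]
    · intro x
      rw [← map_eq_zero_iff f hf, hp, hιπ]
      exact exists_congr fun k => ⟨fun hk => Subtype.ext hk, fun hk => congrArg Subtype.val hk⟩

/-- The pushout of two monomorphisms, with its two cokernel sequences. -/
theorem exists_pushout_of_exact {K A B C D : ModuleCat.{u} S} {i : ↥K →ₗ[S] ↥A}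
    {p : ↥A →ₗ[S] ↥C} {j : ↥K →ₗ[S] ↥B} {q : ↥B →ₗ[S] ↥D} (hi : Function.Injective i)
    (hp : Function.Surjective p) (hip : Function.Exact i p) (hj : Function.Injective j)
    (hq : Function.Surjective q) (hjq : Function.Exact j q) :
    ∃ (P : ModuleCat.{u} S) (a : ↥A →ₗ[S] ↥P) (b : ↥B →ₗ[S] ↥P) (c : ↥P →ₗ[S] ↥C)
      (d : ↥P →ₗ[S] ↥D),
      Function.Injective b ∧ Function.Surjective c ∧ Function.Exact b c ∧
      Function.Injective a ∧ Function.Surjective d ∧ Function.Exact a d := by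
  let N : Submodule S (↥A × ↥B) := LinearMap.range (i.prod (-j))
  have hmem (x : ↥A) (y : ↥B) : (x, y) ∈ N ↔ ∃ k, i k = x ∧ -j k = y := by
    simp [N, Prod.ext_iff]
  have hzero (x : ↥A) (y : ↥B) : N.mkQ (x, y) = 0 ↔ ∃ k, i k = x ∧ -j k = y := by
    rw [Submodule.mkQ_apply, Submodule.Quotient.mk_eq_zero, hmem]
  have hc : N ≤ LinearMap.ker (p.comp (LinearMap.fst S ↥A ↥B)) := by
    rintro _ ⟨k, rfl⟩
    exact hip.apply_apply_eq_zero k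
  have hd : N ≤ LinearMap.ker (q.comp (LinearMap.snd S ↥A ↥B)) := by
    rintro _ ⟨k, rfl⟩
    simp [hjq.apply_apply_eq_zero k]
  have hsurj := N.mkQ_surjective
  refine ⟨ModuleCat.of S ((↥A × ↥B) ⧸ N), N.mkQ.comp (LinearMap.inl S ↥A ↥B),
    N.mkQ.comp (LinearMap.inr S ↥A ↥B), N.liftQ _ hc, N.liftQ _ hd, ?_, ?_, ?_, ?_, ?_, ?_⟩
  · refine (injective_iff_map_eq_zero _).2 fun y hy => ?_
    obtain ⟨k, hk, rfl⟩ := (hzero 0 y).1 hy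
    rw [(map_eq_zero_iff i hi).1 hk, map_zero, neg_zero]
  · intro z
    obtain ⟨x, rfl⟩ := hp z
    exact ⟨N.mkQ (x, 0), rfl⟩
  · intro z
    obtain ⟨⟨x, y⟩, rfl⟩ := hsurj z
    change p x = 0 ↔ _
    refine ⟨fun hx => ?_, ?_⟩
    · obtain ⟨k, rfl⟩ := (hip x).1 hx
      refine ⟨y + j k, ?_⟩
      rw [← sub_eq_zero]
      change N.mkQ ((0, y + j k) - (i k, y)) = 0
      rw [Prod.mk_sub_mk, hzero]
      exact ⟨-k, by simp⟩
    · rintro ⟨y', hy'⟩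
      exact (congrArg (N.liftQ _ hc) hy').symm.trans (map_zero p)
  · refine (injective_iff_map_eq_zero _).2 fun x hx => ?_
    obtain ⟨k, rfl, hk⟩ := (hzero x 0).1 hx
    rw [(map_eq_zero_iff j hj).1 (neg_eq_zero.1 hk), map_zero]
  · intro z
    obtain ⟨y, rfl⟩ := hq z
    exact ⟨N.mkQ (0, y), rfl⟩
  · intro z
    obtain ⟨⟨x, y⟩, rfl⟩ := hsurj z
    change q y = 0 ↔ _
    refine ⟨fun hy => ?_, ?_⟩
    · obtain ⟨k, rfl⟩ := (hjq y).1 hy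
      refine ⟨x + i k, ?_⟩
      rw [← sub_eq_zero]
      change N.mkQ ((x + i k, 0) - (x, j k)) = 0
      rw [Prod.mk_sub_mk, hzero]
      exact ⟨k, by simp⟩
    · rintro ⟨x', hx'⟩
      exact (congrArg (N.liftQ _ hd) hx').symm.trans (map_zero q)

/-- Over a GF-closed ring, a module of Gorenstein flat dimension at most `n` embeds in a module of
flat dimension at most `n` with Gorenstein flat cokernel. -/
theorem gflatDimLE.exists_embedding (h : IsGFClosed S) {n : ℕ} {M : ModuleCat.{u} S}
    (hM : gflatDimLE S n M) :
    ∃ (M' G : ModuleCat.{u} S) (ι : ↥M →ₗ[S] ↥M') (π : ↥M' →ₗ[S] ↥G),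
      Function.Injective ι ∧ Function.Surjective π ∧ Function.Exact ι π ∧
      flatDimLE S n M' ∧ IsGorensteinFlat S G := by
  induction n generalizing M with
  | zero =>
    obtain ⟨G, ⟨F, f, g, hF, hf, hg, hfg⟩, hG⟩ := IsGorensteinFlat.exists_flatStep hM
    exact ⟨F, G, f, g, hf, hg, hfg, hF, hG⟩
  | succ n ih =>
    obtain ⟨K, G₀, ι, π, hι, hπ, hιπ, hG₀, hK⟩ := hM
    obtain ⟨K', G₁, j, q, hj, hq, hjq, hK', hG₁⟩ := ih hK
    obtain ⟨P, a, b, c, d, hb, hc, hbc, ha, hd, had⟩ :=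
      exists_pushout_of_exact hι hπ hιπ hj hq hjq
    have hP : IsGorensteinFlat S P := h _ _ _ a d ha hd had hG₀ hG₁
    obtain ⟨G, ⟨F, f, g, hF, hf, hg, hfg⟩, hG⟩ := hP.exists_flatStep
    let N := LinearMap.range (f.comp b)
    obtain ⟨s, hs⟩ := LinearMap.exists_comp_eq_of_ker_le hc (N.mkQ.comp f) fun x hx => by
      obtain ⟨y, rfl⟩ := (hbc x).1 hx
      exact (Submodule.Quotient.mk_eq_zero N).2 ⟨y, rfl⟩
    have hs' (x : ↥P) : s (c x) = N.mkQ (f x) := LinearMap.congr_fun hs x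
    have hN : N ≤ LinearMap.ker g := by
      rintro _ ⟨y, rfl⟩
      exact hfg.apply_apply_eq_zero (b y)
    refine ⟨ModuleCat.of S (↥F ⧸ N), G, s, N.liftQ g hN, ?_, ?_, ?_,
      ⟨K', F, f.comp b, N.mkQ, hf.comp hb, N.mkQ_surjective, ?_, hF, hK'⟩, hG⟩
    · refine (injective_iff_map_eq_zero s).2 fun m hm => ?_
      obtain ⟨x, rfl⟩ := hc m
      rw [hs'] at hm
      obtain ⟨y, hy⟩ := (Submodule.Quotient.mk_eq_zero N).1 hm
      rw [← hf hy]
      exact hbc.apply_apply_eq_zero y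
    · intro z
      obtain ⟨x, rfl⟩ := hg z
      exact ⟨N.mkQ x, rfl⟩
    · intro z
      obtain ⟨x, rfl⟩ := N.mkQ_surjective z
      change g x = 0 ↔ _
      refine ⟨fun hx => ?_, ?_⟩
      · obtain ⟨y, rfl⟩ := (hfg x).1 hx
        exact ⟨c y, hs' y⟩
      · rintro ⟨m, hm⟩
        obtain ⟨y, rfl⟩ := hc m
        rw [hs'] at hm
        exact (congrArg (N.liftQ g hN) hm).symm.trans (hfg.apply_apply_eq_zero y)
    · exact LinearMap.exact_map_mkQ_range _

end Dimensions

/-- **Lemma 2.2.**  If `R` is a left GF-closed ring and `M` is a left `R`-module with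
`Gfd_R(M) < ∞`, then there is a short exact sequence `0 → M → M' → G → 0` of left `R`-modules
with `fd_R(M') = Gfd_R(M)` and `G` Gorenstein flat.  (The statement for right modules over a
right GF-closed ring is the instance of this theorem at the opposite ring `Rᵐᵒᵖ`.) -/
theorem exists_ses_flatDim_eq_gflatDim_of_isGFClosed (R : Type u) [Ring R]
    (h : IsGFClosed R) (M : ModuleCat.{u} R) (hM : gflatDim R M ≠ ⊤) :
    ∃ (M' G : ModuleCat.{u} R) (ι : ↥M →ₗ[R] ↥M') (π : ↥M' →ₗ[R] ↥G),
      Function.Injective ι ∧ Function.Surjective π ∧ Function.Exact ι π ∧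
      flatDim R M' = gflatDim R M ∧ IsGorensteinFlat R G := by
  obtain ⟨n, hn, hnM⟩ : ∃ n : ℕ, gflatDim R M = n ∧ gflatDimLE R n M := by
    refine csInf_mem (s := {d : ℕ∞ | ∃ n : ℕ, d = n ∧ gflatDimLE R n M}) ?_
    by_contra hempty
    rw [Set.not_nonempty_iff_eq_empty] at hempty
    exact hM ((congrArg sInf hempty).trans sInf_empty)
  obtain ⟨M', G, ι, π, hι, hπ, hιπ, hM', hG⟩ := hnM.exists_embedding h
  refine ⟨M', G, ι, π, hι, hπ, hιπ, le_antisymm ?_ ?_, hG⟩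
  · rw [hn]
    exact sInf_le ⟨n, rfl, hM'⟩
  · refine le_sInf ?_
    rintro _ ⟨m, rfl, hm⟩
    exact sInf_le ⟨m, rfl, hm.gflatDimLE_of_exact hG hι hπ hιπ⟩
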